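/- Let G=(V,E) be a finite simple connected graph with vertex set V={v_1,…,v_k}, k ≥ 2. Let f(x) = A(x)/B(x) be a rational function over ℚ with B(0) ≠ 0 whose power series expansion equals the Ehrhart series Ehr(P(G),x). Then f satisfies the functional equation x^3 · f(x) = (−1)^{k+1} · f(1/x) in the field ℚ(x); equivalently, x^3 · A(x) · B(1/x) = (−1)^{k+1} · A(1/x) · B(x) as rational functions. -/

import Mathlib

open Polynomial PowerSeries Pointwise

/-- The graph polytope `P(G)` of a simple graph `G`:
all points with coordinates in `[0,1]` such that `x i + x j ≤ 1` for every edge `ij`. -/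
def graphPolytope {V : Type*} (G : SimpleGraph V) : Set (V → ℝ) :=
  {x | (∀ i, 0 ≤ x i ∧ x i ≤ 1) ∧ ∀ i j, G.Adj i j → x i + x j ≤ 1}

/-- `ehr P n` is the number of lattice points in the `n`-th dilate `nP` of `P`. -/
noncomputable def ehr {V : Type*} (P : Set (V → ℝ)) (n : ℕ) : ℕ :=
  Set.ncard {m : V → ℤ | (fun i => (m i : ℝ)) ∈ (n : ℝ) • P}

/-- The Ehrhart series `Ehr(P, x) = Σ_{n ≥ 0} ehr(P,n) xⁿ` as a formal power series over `ℚ`. -/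
noncomputable def ehrSeries {V : Type*} (P : Set (V → ℝ)) : PowerSeries ℚ :=
  PowerSeries.mk fun n => (ehr P n : ℚ)


/-- chains with prescribed gaps -/
def Fset (K : ℕ) (d : Fin K → ℕ) (r ε n : ℕ) : Finset (Fin (K+1) → ℕ) :=
  (Fintype.piFinset fun _ => Finset.range (n+1)).filter (fun s =>
    (∀ i : Fin K, s i.succ + d i ≤ s i.castSucc) ∧ r ≤ s (Fin.last K) ∧ ∀ i, 2 * s i + ε ≤ n)

lemma mem_Fset {K : ℕ} {d : Fin K → ℕ} {r ε n : ℕ} {s : Fin (K+1) → ℕ} :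
    s ∈ Fset K d r ε n ↔ (∀ i : Fin K, s i.succ + d i ≤ s i.castSucc) ∧ r ≤ s (Fin.last K) ∧
      ∀ i, 2 * s i + ε ≤ n := by
  unfold Fset
  rw [Finset.mem_filter, and_iff_right_iff_imp]
  rintro ⟨_, _, h⟩
  rw [Fintype.mem_piFinset]
  intro i
  have := h i
  rw [Finset.mem_range]; omega

lemma last_le {K : ℕ} {d : Fin K → ℕ} {s : Fin (K+1) → ℕ}
    (h : ∀ i : Fin K, s i.succ + d i ≤ s i.castSucc) (i : Fin (K+1)) :
    s (Fin.last K) ≤ s i := by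
  have : Antitone s := Fin.antitone_iff_succ_le.2 (fun i => by have := h i; omega)
  exact this (Fin.le_last i)

lemma gf_step (F F' : ℕ → ℕ) (h0 : F 0 = F' 0) (h1 : F 1 = F' 1)
    (h : ∀ n, F (n+2) = F' (n+2) + F n) :
    (PowerSeries.mk fun n => (F n : ℚ)) * (1 - PowerSeries.X ^ 2) =
      PowerSeries.mk fun n => (F' n : ℚ) := by
  ext n
  rw [mul_sub, mul_one, map_sub, PowerSeries.coeff_mul_X_pow', PowerSeries.coeff_mk,
    PowerSeries.coeff_mk]
  match n with
  | 0 => simp [h0]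
  | 1 => simp [h1]
  | n+2 => simp [h n]

lemma Fset_split {K : ℕ} (d : Fin K → ℕ) (r ε n : ℕ) :
    (Fset K d r ε (n+2)).card =
      ((Fset K d r ε (n+2)).filter (fun s => s (Fin.last K) = r)).card + (Fset K d r ε n).card := by
  rw [← Finset.card_filter_add_card_filter_not (s := Fset K d r ε (n+2)) (fun s => s (Fin.last K) = r)]
  congr 1
  refine Finset.card_nbij' (fun s i => s i - 1) (fun s i => s i + 1) ?_ ?_ ?_ ?_
  · intro s hs
    simp only [Finset.coe_filter, Set.mem_ofPred_eq, mem_Fset, Finset.mem_coe] at hs ⊢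
    obtain ⟨⟨h1, h2, h3⟩, h4⟩ := hs
    have hl := last_le h1
    refine ⟨fun i => ?_, ?_, fun i => ?_⟩
    · have := h1 i; have := hl i.succ; have := hl i.castSucc; omega
    · omega
    · have := h3 i; have := hl i; omega
  · intro s hs
    simp only [Finset.coe_filter, Set.mem_ofPred_eq, mem_Fset, Finset.mem_coe] at hs ⊢
    obtain ⟨h1, h2, h3⟩ := hs
    refine ⟨⟨fun i => ?_, ?_, fun i => ?_⟩, ?_⟩
    · have := h1 i; omega
    · omega
    · have := h3 i; omega
    · omega
  · intro s hs
    simp only [Finset.coe_filter, Set.mem_ofPred_eq, mem_Fset] at hs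
    obtain ⟨⟨h1, h2, h3⟩, h4⟩ := hs
    have hl := last_le h1
    funext i
    have := hl i
    dsimp only
    omega
  · intro s hs
    funext i
    simp

lemma Fset_small {K : ℕ} (d : Fin K → ℕ) (r ε n : ℕ) (hn : n < 2) :
    (Fset K d r ε n).card =
      ((Fset K d r ε n).filter (fun s => s (Fin.last K) = r)).card := by
  congr 1
  symm
  rw [Finset.filter_eq_self]
  intro s hs
  rw [mem_Fset] at hs
  have := hs.2.2 (Fin.last K)
  omega

lemma Fset_gf_step {K : ℕ} (d : Fin K → ℕ) (r ε : ℕ) :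
    (PowerSeries.mk fun n => ((Fset K d r ε n).card : ℚ)) * (1 - PowerSeries.X ^ 2) =
      PowerSeries.mk fun n =>
        (((Fset K d r ε n).filter (fun s => s (Fin.last K) = r)).card : ℚ) :=
  gf_step _ (fun n => ((Fset K d r ε n).filter (fun s => s (Fin.last K) = r)).card)
    (Fset_small _ _ _ _ (by norm_num)) (Fset_small _ _ _ _ (by norm_num))
    (fun n => Fset_split _ _ _ _)

lemma Fset_zero_filter (d : Fin 0 → ℕ) (r ε n : ℕ) :
    ((Fset 0 d r ε n).filter (fun s => s (Fin.last 0) = r)).card =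
      if 2 * r + ε ≤ n then 1 else 0 := by
  split_ifs with h
  · rw [Finset.card_eq_one]
    refine ⟨fun _ => r, ?_⟩
    ext s
    rw [Finset.mem_filter, mem_Fset, Finset.mem_singleton]
    constructor
    · rintro ⟨_, h2⟩
      funext i
      rw [← h2]; congr 1; exact Fin.ext (by have := i.isLt; simp)
    · rintro rfl
      exact ⟨⟨fun i => i.elim0, le_rfl, fun _ => h⟩, rfl⟩
  · rw [Finset.card_eq_zero, Finset.filter_eq_empty_iff]
    intro s hs h2
    rw [mem_Fset] at hs
    have := hs.2.2 (Fin.last 0)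
    omega

lemma Fset_succ_filter {K : ℕ} (d : Fin (K+1) → ℕ) (r ε n : ℕ) :
    ((Fset (K+1) d r ε n).filter (fun s => s (Fin.last (K+1)) = r)).card =
      (Fset K (fun i => d i.castSucc) (r + d (Fin.last K)) ε n).card := by
  refine Finset.card_nbij' (fun s i => s i.castSucc) (fun s => Fin.snoc (α := fun _ => ℕ) s r) ?_ ?_ ?_ ?_
  · intro s hs
    simp only [Finset.coe_filter, Set.mem_ofPred_eq, mem_Fset, Finset.mem_coe] at hs ⊢
    obtain ⟨⟨h1, h2, h3⟩, h4⟩ := hs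
    refine ⟨fun i => ?_, ?_, fun i => h3 _⟩
    · have := h1 i.castSucc
      rwa [Fin.succ_castSucc] at this
    · have := h1 (Fin.last K)
      rw [Fin.succ_last] at this; change s (Fin.last K.succ) = r at h4; omega
  · intro s hs
    simp only [Finset.coe_filter, Set.mem_ofPred_eq, mem_Fset, Finset.mem_coe] at hs ⊢
    obtain ⟨h1, h2, h3⟩ := hs
    refine ⟨⟨fun i => ?_, ?_, fun i => ?_⟩, by simp⟩
    · induction i using Fin.lastCases with
      | last => rw [Fin.succ_last]; simpa using h2
      | cast i =>
        rw [Fin.succ_castSucc, Fin.snoc_castSucc, Fin.snoc_castSucc]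
        exact h1 i
    · simp
    · induction i using Fin.lastCases with
      | last => have := h3 (Fin.last K); simp; omega
      | cast i => simpa using h3 i
  · intro s hs
    simp only [Finset.coe_filter, Set.mem_ofPred_eq, mem_Fset] at hs
    funext i
    induction i using Fin.lastCases with
    | last => simp [hs.2]
    | cast i => simp
  · intro s hs
    funext i
    simp

lemma Fset_gf (K : ℕ) (d : Fin K → ℕ) (r ε : ℕ) :
    (PowerSeries.mk fun n => ((Fset K d r ε n).card : ℚ)) *
      ((1 - PowerSeries.X) * (1 - PowerSeries.X ^ 2) ^ (K+1)) =
      PowerSeries.X ^ (ε + 2 * (r + ∑ i, d i)) := by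
  induction K generalizing r with
  | zero =>
    have := Fset_gf_step d r ε
    have e : ((1 : PowerSeries ℚ) - PowerSeries.X) * (1 - PowerSeries.X ^ 2) ^ (0+1) =
        (1 - PowerSeries.X ^ 2) * (1 - PowerSeries.X) := by ring
    rw [e, ← mul_assoc, this]
    simp only [Fset_zero_filter]
    ext n
    rw [mul_sub, mul_one, map_sub]
    cases n with
    | zero => simp [PowerSeries.coeff_X_pow]; grind
    | succ n =>
      rw [PowerSeries.coeff_succ_mul_X]; simp [PowerSeries.coeff_X_pow]; grind
  | succ K ih =>
    have h := Fset_gf_step d r ε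
    simp only [Fset_succ_filter] at h
    have h2 := ih (fun i => d i.castSucc) (r + d (Fin.last K))
    rw [← h] at h2
    rw [pow_succ]
    rw [Fin.sum_univ_castSucc]
    calc _ = _ := by ring
      _ = _ := h2
      _ = _ := by ring

/-- sorting key: descending in `z`, ties broken by `ℓ` -/
def skey {m : ℕ} (z ℓ : Fin m → ℕ) (i : Fin m) : Lex (ℕᵒᵈ × ℕ) :=
  toLex (OrderDual.toDual (z i), ℓ i)

lemma skey_lt {m : ℕ} (z ℓ : Fin m → ℕ) (i j : Fin m) :
    skey z ℓ i < skey z ℓ j ↔ z j < z i ∨ (z i = z j ∧ ℓ i < ℓ j) := by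
  unfold skey
  rw [Prod.Lex.toLex_lt_toLex]
  simp

lemma skey_inj {m : ℕ} (z ℓ : Fin m → ℕ) (hℓ : Function.Injective ℓ) :
    Function.Injective (skey z ℓ) := by
  intro i j h
  apply hℓ
  have := congrArg (fun x => (ofLex x).2) h
  simpa [skey] using this

lemma sort_strict {m : ℕ} (z ℓ : Fin m → ℕ) (hℓ : Function.Injective ℓ) :
    StrictMono (skey z ℓ ∘ Tuple.sort (skey z ℓ)) :=
  (Tuple.monotone_sort _).strictMono_of_injective
    ((skey_inj z ℓ hℓ).comp (Equiv.injective _))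

lemma sort_unique {m : ℕ} (z ℓ : Fin m → ℕ) (hℓ : Function.Injective ℓ)
    (σ : Equiv.Perm (Fin m)) :
    Tuple.sort (skey z ℓ) = σ ↔ StrictMono (skey z ℓ ∘ σ) := by
  constructor
  · rintro rfl; exact sort_strict z ℓ hℓ
  · intro h
    have := Tuple.unique_monotone (Tuple.monotone_sort (skey z ℓ)) h.monotone
    ext1 i
    exact skey_inj z ℓ hℓ (congrFun this i)

open Classical in
/-- compatible linear orders -/
noncomputable def Lset {m : ℕ} (G : SimpleGraph (Fin m)) (S : Finset (Fin m)) :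
    Finset (Equiv.Perm (Fin m)) :=
  Finset.univ.filter (fun σ => ∀ i ∈ S, ∀ j, G.Adj i j → j ∉ S ∧ σ.symm i < σ.symm j)

open Classical in
/-- reflected points of type `S` -/
noncomputable def Zset {m : ℕ} (G : SimpleGraph (Fin m)) (S T : Finset (Fin m)) (ℓ : Fin m → ℕ)
    (r n : ℕ) : Finset (Fin m → ℕ) :=
  (Fintype.piFinset fun _ => Finset.range (n+1)).filter (fun z =>
    (∀ i, r ≤ z i ∧ 2 * z i + (if i ∈ T then 1 else 0) ≤ n) ∧
    ∀ i ∈ S, ∀ j, G.Adj i j → j ∉ S ∧ skey z ℓ i < skey z ℓ j)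

lemma mem_Zset {m : ℕ} {G : SimpleGraph (Fin m)} {S T : Finset (Fin m)} {ℓ : Fin m → ℕ}
    {r n : ℕ} {z : Fin m → ℕ} : z ∈ Zset G S T ℓ r n ↔
    (∀ i, r ≤ z i ∧ 2 * z i + (if i ∈ T then 1 else 0) ≤ n) ∧
    ∀ i ∈ S, ∀ j, G.Adj i j → j ∉ S ∧ skey z ℓ i < skey z ℓ j := by
  classical
  unfold Zset
  rw [Finset.mem_filter, and_iff_right_iff_imp]
  rintro ⟨h, _⟩
  rw [Fintype.mem_piFinset]
  intro i
  have := (h i).2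
  rw [Finset.mem_range]; omega

lemma chain_iff {K : ℕ} (s u : Fin (K+1) → ℕ) (hu : Function.Injective u) :
    StrictMono (skey s u) ↔
      ∀ i : Fin K, s i.succ + (if u i.succ < u i.castSucc then 1 else 0) ≤ s i.castSucc := by
  rw [Fin.strictMono_iff_lt_succ]
  refine forall_congr' fun i => ?_
  rw [skey_lt]
  have : u i.succ ≠ u i.castSucc := fun h => by
    have := congrArg Fin.val (hu h)
    simp at this
  split_ifs <;> omega

lemma Zset_card {K : ℕ} (G : SimpleGraph (Fin (K+1))) (S T : Finset (Fin (K+1)))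
    (ℓ : Fin (K+1) → ℕ) (hℓ : Function.Injective ℓ)
    (hT : ∀ i ∈ T, ∀ j, j ∉ T → ℓ i < ℓ j) (r n : ℕ) :
    (Zset G S T ℓ r n).card = ∑ σ ∈ Lset G S,
      (Fset K (fun i => if ℓ (σ i.succ) < ℓ (σ i.castSucc) then 1 else 0) r
        (if σ 0 ∈ T then 1 else 0) n).card := by
  classical
  rw [Finset.card_eq_sum_card_fiberwise (f := fun z => Tuple.sort (skey z ℓ)) (t := Lset G S)]
  · refine Finset.sum_congr rfl fun σ hσ => ?_
    have hσ' : ∀ i ∈ S, ∀ j, G.Adj i j → j ∉ S ∧ σ.symm i < σ.symm j := by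
      simpa [Lset] using hσ
    have hu : Function.Injective (ℓ ∘ σ) := hℓ.comp σ.injective
    refine Finset.card_nbij' (fun z => z ∘ σ) (fun s => s ∘ σ.symm) ?_ ?_ ?_ ?_
    · intro z hz
      simp only [Finset.coe_filter, Set.mem_ofPred_eq, Finset.mem_coe] at hz ⊢
      obtain ⟨hz, hs⟩ := hz
      rw [sort_unique z ℓ hℓ] at hs
      rw [mem_Zset] at hz
      have hs' : StrictMono (skey (z ∘ σ) (ℓ ∘ σ)) := hs
      have hc := (chain_iff _ _ hu).1 hs'
      have ha : Antitone (z ∘ σ) := Fin.antitone_iff_succ_le.2 (fun i => by have := hc i; omega)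
      rw [mem_Fset]
      refine ⟨hc, (hz.1 _).1, fun i => ?_⟩
      have h0 := (hz.1 (σ 0)).2
      have h1 := ha (Fin.zero_le i)
      simp only [Function.comp] at h1 ⊢
      omega
    · intro s hs
      simp only [Finset.coe_filter, Set.mem_ofPred_eq, Finset.mem_coe] at hs ⊢
      rw [mem_Fset] at hs
      obtain ⟨hc, hr, hb⟩ := hs
      have hm : StrictMono (skey s (ℓ ∘ σ)) := (chain_iff _ _ hu).2 hc
      have hm' : StrictMono (skey (s ∘ σ.symm) ℓ ∘ σ) := by
        convert hm using 1
        funext i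
        simp [skey]
      refine ⟨?_, (sort_unique _ ℓ hℓ σ).2 hm'⟩
      rw [mem_Zset]
      refine ⟨fun i => ⟨hr.trans (last_le hc _), ?_⟩, fun i hi j hj => ?_⟩
      · have h1 := hb (σ.symm i)
        simp only [Function.comp]
        by_cases hi : i ∈ T
        · by_cases h0 : σ 0 ∈ T
          · simpa [hi, h0] using h1
          · have hne : (0 : Fin (K+1)) < σ.symm i := by
              rw [Fin.pos_iff_ne_zero]
              intro h
              apply h0
              rw [← h]; simpa using hi
            have := hm hne
            rw [skey_lt] at this
            have h2 := hT i hi _ h0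
            have h3 := hb 0
            simp only [Function.comp, Equiv.apply_symm_apply] at this
            simp only [hi, if_true]
            omega
        · simp only [hi, if_false]; omega
      · refine ⟨(hσ' i hi j hj).1, ?_⟩
        have := hm' (hσ' i hi j hj).2
        simpa using this
    · intro z _
      funext i; simp
    · intro s _
      funext i; simp
  · intro z hz
    rw [Finset.mem_coe, mem_Zset] at hz
    simp only [Lset, Finset.coe_filter, Set.mem_ofPred_eq, Finset.mem_univ, true_and]
    intro i hi j hj
    refine ⟨(hz.2 i hi j hj).1, ?_⟩
    rw [← (sort_strict z ℓ hℓ).lt_iff_lt]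
    simpa using (hz.2 i hi j hj).2

/-- exponent -/
def Eexp {K : ℕ} (T : Finset (Fin (K+1))) (ℓ : Fin (K+1) → ℕ) (r : ℕ)
    (σ : Equiv.Perm (Fin (K+1))) : ℕ :=
  (if σ 0 ∈ T then 1 else 0) +
    2 * (r + ∑ i : Fin K, if ℓ (σ i.succ) < ℓ (σ i.castSucc) then 1 else 0)

lemma Zset_gf {K : ℕ} (G : SimpleGraph (Fin (K+1))) (S T : Finset (Fin (K+1)))
    (ℓ : Fin (K+1) → ℕ) (hℓ : Function.Injective ℓ)
    (hT : ∀ i ∈ T, ∀ j, j ∉ T → ℓ i < ℓ j) (r : ℕ) :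
    (PowerSeries.mk fun n => ((Zset G S T ℓ r n).card : ℚ)) *
      ((1 - PowerSeries.X) * (1 - PowerSeries.X ^ 2) ^ (K+1)) =
      ∑ σ ∈ Lset G S, PowerSeries.X ^ Eexp T ℓ r σ := by
  have : (PowerSeries.mk fun n => ((Zset G S T ℓ r n).card : ℚ)) = ∑ σ ∈ Lset G S,
      PowerSeries.mk fun n =>
      ((Fset K (fun i => if ℓ (σ i.succ) < ℓ (σ i.castSucc) then 1 else 0) r
        (if σ 0 ∈ T then 1 else 0) n).card : ℚ) := by
    ext n
    rw [PowerSeries.coeff_mk, Zset_card G S T ℓ hℓ hT, map_sum]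
    push_cast
    simp only [PowerSeries.coeff_mk]
  rw [this, Finset.sum_mul]
  refine Finset.sum_congr rfl fun σ _ => ?_
  rw [Fset_gf]; rfl

/-- labels: elements of `S` come first -/
def lab {m : ℕ} (S : Finset (Fin m)) (i : Fin m) : ℕ := if i ∈ S then i.val else i.val + m

/-- reversed labels -/
def labr {m : ℕ} (S : Finset (Fin m)) (i : Fin m) : ℕ := 2 * m - lab S i

lemma lab_lt {m : ℕ} (S : Finset (Fin m)) (i : Fin m) : lab S i < 2 * m := by
  unfold lab; have := i.isLt; split_ifs <;> omega

lemma lab_inj {m : ℕ} (S : Finset (Fin m)) : Function.Injective (lab S) := by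
  intro i j h
  unfold lab at h
  have := i.isLt
  have := j.isLt
  apply Fin.ext
  split_ifs at h <;> omega

lemma labr_inj {m : ℕ} (S : Finset (Fin m)) : Function.Injective (labr S) := by
  intro i j h
  unfold labr at h
  apply lab_inj S
  have := lab_lt S i
  have := lab_lt S j
  omega

lemma lab_sep {m : ℕ} (S : Finset (Fin m)) (i : Fin m) (hi : i ∈ S) (j : Fin m) (hj : j ∉ S) :
    lab S i < lab S j := by
  unfold lab; have := i.isLt; simp only [hi, hj, if_true, if_false]; omega

lemma labr_lt {m : ℕ} (S : Finset (Fin m)) (i j : Fin m) :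
    labr S i < labr S j ↔ lab S j < lab S i := by
  unfold labr; have := lab_lt S i; have := lab_lt S j; omega

open Classical in
/-- lattice points of the dilate -/
noncomputable def Cset {m : ℕ} (G : SimpleGraph (Fin m)) (n : ℕ) : Finset (Fin m → ℕ) :=
  (Fintype.piFinset fun _ => Finset.range (n+1)).filter (fun x =>
    (∀ i, x i ≤ n) ∧ ∀ i j, G.Adj i j → x i + x j ≤ n)

open Classical in
/-- interior lattice points of the dilate -/
noncomputable def Oset {m : ℕ} (G : SimpleGraph (Fin m)) (n : ℕ) : Finset (Fin m → ℕ) :=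
  (Fintype.piFinset fun _ => Finset.range (n+1)).filter (fun x =>
    (∀ i, 0 < x i ∧ x i < n) ∧ ∀ i j, G.Adj i j → x i + x j < n)

lemma mem_Cset {m : ℕ} {G : SimpleGraph (Fin m)} {n : ℕ} {x : Fin m → ℕ} :
    x ∈ Cset G n ↔ (∀ i, x i ≤ n) ∧ ∀ i j, G.Adj i j → x i + x j ≤ n := by
  classical
  unfold Cset
  rw [Finset.mem_filter, and_iff_right_iff_imp]
  rintro ⟨h, _⟩
  rw [Fintype.mem_piFinset]
  intro i
  have := h i
  rw [Finset.mem_range]; omega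

lemma mem_Oset {m : ℕ} {G : SimpleGraph (Fin m)} {n : ℕ} {x : Fin m → ℕ} :
    x ∈ Oset G n ↔ (∀ i, 0 < x i ∧ x i < n) ∧ ∀ i j, G.Adj i j → x i + x j < n := by
  classical
  unfold Oset
  rw [Finset.mem_filter, and_iff_right_iff_imp]
  rintro ⟨h, _⟩
  rw [Fintype.mem_piFinset]
  intro i
  have := h i
  rw [Finset.mem_range]; omega

lemma Cset_card {m : ℕ} (G : SimpleGraph (Fin m)) (n : ℕ) :
    (Cset G n).card = ∑ S : Finset (Fin m), (Zset G S S (lab S) 0 n).card := by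
  classical
  rw [Finset.card_eq_sum_card_fiberwise
    (f := fun x => Finset.univ.filter (fun i => n < 2 * x i)) (t := Finset.univ)
    (fun _ _ => Finset.mem_coe.2 (Finset.mem_univ _))]
  refine Finset.sum_congr rfl fun S _ => ?_
  refine Finset.card_nbij' (fun x i => if i ∈ S then n - x i else x i)
    (fun x i => if i ∈ S then n - x i else x i) ?_ ?_ ?_ ?_
  · intro x hx
    simp only [Finset.coe_filter, Set.mem_ofPred_eq, Finset.mem_coe, mem_Cset] at hx
    obtain ⟨⟨h1, h2⟩, hS⟩ := hx
    have hS' : ∀ i, i ∈ S ↔ n < 2 * x i := fun i => by rw [← hS]; simp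
    rw [Finset.mem_coe, mem_Zset]
    refine ⟨fun i => ⟨Nat.zero_le _, ?_⟩, fun i hi j hj => ?_⟩
    · have := h1 i; have := hS' i
      by_cases hi : i ∈ S
      · simp only [hi, if_true, true_iff] at this ⊢; omega
      · simp only [hi, if_false, false_iff] at this ⊢; omega
    · have hij := h2 i j hj
      have hi' := (hS' i).1 hi
      have hj' : j ∉ S := by rw [hS']; omega
      refine ⟨hj', ?_⟩
      rw [skey_lt]
      have := lab_sep S i hi j hj'
      simp only [hi, hj', if_true, if_false]
      omega
  · intro z hz
    rw [Finset.mem_coe, mem_Zset] at hz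
    obtain ⟨h1, h2⟩ := hz
    simp only [Finset.coe_filter, Set.mem_ofPred_eq, mem_Cset]
    have key : ∀ i j, G.Adj i j → i ∈ S →
        (if i ∈ S then n - z i else z i) + (if j ∈ S then n - z j else z j) ≤ n := by
      intro i j hij hi
      have h := h2 i hi j hij
      rw [skey_lt] at h
      have := (h1 i).2
      simp only [hi, h.1, if_true, if_false] at this ⊢
      omega
    refine ⟨⟨fun i => ?_, fun i j hij => ?_⟩, ?_⟩
    · have := (h1 i).2; split_ifs at * <;> omega
    · by_cases hi : i ∈ S
      · exact key i j hij hi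
      · by_cases hj : j ∈ S
        · rw [add_comm]; exact key j i hij.symm hj
        · have := (h1 i).2; have := (h1 j).2
          simp only [hi, hj, if_false] at *; omega
    · ext i
      simp only [Finset.mem_filter, Finset.mem_univ, true_and]
      have := (h1 i).2
      by_cases hi : i ∈ S
      · simp only [hi, if_true, iff_true] at *; omega
      · simp only [hi, if_false, iff_false] at *; omega
  · intro x hx
    simp only [Finset.coe_filter, Set.mem_ofPred_eq, mem_Cset] at hx
    funext i
    have := hx.1.1 i
    dsimp only
    split_ifs <;> omega
  · intro z hz
    rw [Finset.mem_coe, mem_Zset] at hz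
    funext i
    have := (hz.1 i).2
    dsimp only
    split_ifs at * <;> omega

lemma Oset_card {m : ℕ} (G : SimpleGraph (Fin m)) (n : ℕ) :
    (Oset G n).card = ∑ S : Finset (Fin m), (Zset G S Sᶜ (labr S) 1 n).card := by
  classical
  rw [Finset.card_eq_sum_card_fiberwise
    (f := fun x => Finset.univ.filter (fun i => n ≤ 2 * x i)) (t := Finset.univ)
    (fun _ _ => Finset.mem_coe.2 (Finset.mem_univ _))]
  refine Finset.sum_congr rfl fun S _ => ?_
  refine Finset.card_nbij' (fun x i => if i ∈ S then n - x i else x i)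
    (fun x i => if i ∈ S then n - x i else x i) ?_ ?_ ?_ ?_
  · intro x hx
    simp only [Finset.coe_filter, Set.mem_ofPred_eq, mem_Oset] at hx
    obtain ⟨⟨h1, h2⟩, hS⟩ := hx
    have hS' : ∀ i, i ∈ S ↔ n ≤ 2 * x i := fun i => by rw [← hS]; simp
    rw [Finset.mem_coe, mem_Zset]
    refine ⟨fun i => ?_, fun i hi j hj => ?_⟩
    · have := h1 i; have := hS' i
      simp only [Finset.mem_compl]
      by_cases hi : i ∈ S
      · simp only [hi, if_true, true_iff, not_true, if_false] at this ⊢; omega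
      · simp only [hi, if_false, false_iff, not_false_iff, if_true] at this ⊢; omega
    · have hij := h2 i j hj
      have hi' := (hS' i).1 hi
      have hj' : j ∉ S := by rw [hS']; omega
      refine ⟨hj', ?_⟩
      rw [skey_lt]
      simp only [hi, hj', if_true, if_false]
      omega
  · intro z hz
    rw [Finset.mem_coe, mem_Zset] at hz
    obtain ⟨h1, h2⟩ := hz
    simp only [Finset.mem_compl] at h1
    simp only [Finset.coe_filter, Set.mem_ofPred_eq, mem_Oset]
    have key : ∀ i j, G.Adj i j → i ∈ S →
        (if i ∈ S then n - z i else z i) + (if j ∈ S then n - z j else z j) < n := by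
      intro i j hij hi
      have h := h2 i hi j hij
      rw [skey_lt, labr_lt] at h
      have := (h1 i).2
      have := lab_sep S i hi j h.1
      simp only [hi, h.1, if_true, if_false, not_true] at *
      omega
    refine ⟨⟨fun i => ?_, fun i j hij => ?_⟩, ?_⟩
    · have := h1 i
      by_cases hi : i ∈ S
      · simp only [hi, if_true, not_true, if_false] at *; omega
      · simp only [hi, if_false, not_false_iff, if_true] at *; omega
    · by_cases hi : i ∈ S
      · exact key i j hij hi
      · by_cases hj : j ∈ S
        · rw [add_comm]; exact key j i hij.symm hj
        · have := (h1 i).2; have := (h1 j).2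
          simp only [hi, hj, if_false, not_false_iff, if_true] at *; omega
    · ext i
      simp only [Finset.mem_filter, Finset.mem_univ, true_and]
      have := (h1 i).2
      by_cases hi : i ∈ S
      · simp only [hi, if_true, iff_true, not_true, if_false] at *; omega
      · simp only [hi, if_false, iff_false, not_false_iff, if_true] at *; omega
  · intro x hx
    simp only [Finset.coe_filter, Set.mem_ofPred_eq, mem_Oset] at hx
    funext i
    have := hx.1.1 i
    dsimp only
    split_ifs <;> omega
  · intro z hz
    rw [Finset.mem_coe, mem_Zset] at hz
    funext i
    have := (hz.1 i).2
    dsimp only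
    split_ifs at * <;> omega

lemma Oset_shift {m : ℕ} (G : SimpleGraph (Fin m)) (hG : ∀ i, ∃ j, G.Adj i j) (n : ℕ) :
    (Oset G (n+3)).card = (Cset G n).card := by
  refine Finset.card_nbij' (fun x i => x i - 1) (fun x i => x i + 1) ?_ ?_ ?_ ?_
  · intro x hx
    rw [Finset.mem_coe, mem_Oset] at hx
    rw [Finset.mem_coe, mem_Cset]
    refine ⟨fun i => ?_, fun i j hij => ?_⟩
    · obtain ⟨j, hj⟩ := hG i
      have := hx.2 i j hj; have := hx.1 i; have := hx.1 j
      dsimp only; omega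
    · have := hx.2 i j hij; have := hx.1 i; have := hx.1 j
      dsimp only; omega
  · intro x hx
    rw [Finset.mem_coe, mem_Cset] at hx
    rw [Finset.mem_coe, mem_Oset]
    refine ⟨fun i => ?_, fun i j hij => ?_⟩
    · have := hx.1 i; dsimp only; omega
    · have := hx.2 i j hij; dsimp only; omega
  · intro x hx
    rw [Finset.mem_coe, mem_Oset] at hx
    funext i
    have := hx.1 i
    dsimp only
    omega
  · intro x _
    funext i; simp

lemma Oset_small {m : ℕ} (hm : 0 < m) (G : SimpleGraph (Fin m)) (hG : ∀ i, ∃ j, G.Adj i j)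
    (n : ℕ) (hn : n < 3) : (Oset G n).card = 0 := by
  rw [Finset.card_eq_zero, Finset.eq_empty_iff_forall_notMem]
  intro x hx
  rw [mem_Oset] at hx
  obtain ⟨j, hj⟩ := hG ⟨0, hm⟩
  have := hx.2 _ _ hj; have := hx.1 ⟨0, hm⟩; have := hx.1 j
  omega

lemma O_series {m : ℕ} (hm : 0 < m) (G : SimpleGraph (Fin m)) (hG : ∀ i, ∃ j, G.Adj i j) :
    (PowerSeries.mk fun n => ((Oset G n).card : ℚ)) =
      PowerSeries.X ^ 3 * PowerSeries.mk fun n => ((Cset G n).card : ℚ) := by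
  ext n
  rw [PowerSeries.coeff_X_pow_mul', PowerSeries.coeff_mk]
  split_ifs with h
  · obtain ⟨n, rfl⟩ := Nat.exists_eq_add_of_le' h
    rw [Oset_shift G hG]; simp
  · rw [Oset_small hm G hG n (by omega)]; simp

lemma Eexp_add {K : ℕ} (S : Finset (Fin (K+1))) (σ : Equiv.Perm (Fin (K+1))) :
    Eexp S (lab S) 0 σ + Eexp Sᶜ (labr S) 1 σ = 2 * K + 3 := by
  unfold Eexp
  have h : (∑ i : Fin K, if lab S (σ i.succ) < lab S (σ i.castSucc) then 1 else 0) +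
      (∑ i : Fin K, if labr S (σ i.succ) < labr S (σ i.castSucc) then 1 else 0) = K := by
    rw [← Finset.sum_add_distrib]
    have : ∀ i : Fin K, ((if lab S (σ i.succ) < lab S (σ i.castSucc) then 1 else 0) +
        (if labr S (σ i.succ) < labr S (σ i.castSucc) then 1 else 0)) = 1 := by
      intro i
      simp only [labr_lt]
      have : lab S (σ i.succ) ≠ lab S (σ i.castSucc) := fun h => by
        have := congrArg Fin.val (σ.injective (lab_inj S h))
        simp at this
      split_ifs <;> omega
    simp [this]
  simp only [Finset.mem_compl]
  by_cases h0 : σ 0 ∈ S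
  · simp only [h0, if_true, not_true, if_false]; omega
  · simp only [h0, if_false, not_false_iff, if_true]; omega

/-- numerator -/
noncomputable def hpol {K : ℕ} (G : SimpleGraph (Fin (K+1))) : Polynomial ℚ :=
  ∑ S : Finset (Fin (K+1)), ∑ σ ∈ Lset G S, Polynomial.X ^ Eexp S (lab S) 0 σ

/-- numerator for the interior -/
noncomputable def hpol' {K : ℕ} (G : SimpleGraph (Fin (K+1))) : Polynomial ℚ :=
  ∑ S : Finset (Fin (K+1)), ∑ σ ∈ Lset G S, Polynomial.X ^ Eexp Sᶜ (labr S) 1 σ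

/-- denominator -/
noncomputable def dpol (K : ℕ) : Polynomial ℚ :=
  (1 - Polynomial.X) * (1 - Polynomial.X ^ 2) ^ (K+1)

lemma coe_dpol (K : ℕ) : (dpol K : PowerSeries ℚ) =
    (1 - PowerSeries.X) * (1 - PowerSeries.X ^ 2) ^ (K+1) := by
  simp [dpol]

lemma C_gf {K : ℕ} (G : SimpleGraph (Fin (K+1))) :
    (PowerSeries.mk fun n => ((Cset G n).card : ℚ)) * (dpol K : PowerSeries ℚ) =
      (hpol G : PowerSeries ℚ) := by
  have : (PowerSeries.mk fun n => ((Cset G n).card : ℚ)) = ∑ S : Finset (Fin (K+1)),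
      PowerSeries.mk fun n => ((Zset G S S (lab S) 0 n).card : ℚ) := by
    ext n
    rw [PowerSeries.coeff_mk, Cset_card, map_sum]
    push_cast
    simp only [PowerSeries.coeff_mk]
  rw [this, Finset.sum_mul, coe_dpol, hpol, ← Polynomial.coeToPowerSeries.ringHom_apply, map_sum]
  refine Finset.sum_congr rfl fun S _ => ?_
  rw [Zset_gf G S S (lab S) (lab_inj S) (lab_sep S), map_sum]
  simp

lemma O_gf {K : ℕ} (G : SimpleGraph (Fin (K+1))) :
    (PowerSeries.mk fun n => ((Oset G n).card : ℚ)) * (dpol K : PowerSeries ℚ) =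
      (hpol' G : PowerSeries ℚ) := by
  have : (PowerSeries.mk fun n => ((Oset G n).card : ℚ)) = ∑ S : Finset (Fin (K+1)),
      PowerSeries.mk fun n => ((Zset G S Sᶜ (labr S) 1 n).card : ℚ) := by
    ext n
    rw [PowerSeries.coeff_mk, Oset_card, map_sum]
    push_cast
    simp only [PowerSeries.coeff_mk]
  rw [this, Finset.sum_mul, coe_dpol, hpol', ← Polynomial.coeToPowerSeries.ringHom_apply, map_sum]
  refine Finset.sum_congr rfl fun S _ => ?_
  rw [Zset_gf G S Sᶜ (labr S) (labr_inj S) (fun i hi j hj => ?_), map_sum]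
  · simp
  · rw [labr_lt]
    rw [Finset.mem_compl] at hi hj
    exact lab_sep S j (not_not.1 hj) i hi

lemma hpol_rel {K : ℕ} (G : SimpleGraph (Fin (K+1))) (hG : ∀ i, ∃ j, G.Adj i j) :
    hpol' G = Polynomial.X ^ 3 * hpol G := by
  apply Polynomial.coe_injective
  rw [← O_gf, O_series (Nat.succ_pos K) G hG, mul_assoc, C_gf]
  simp

lemma hpol_inv {K : ℕ} (G : SimpleGraph (Fin (K+1))) :
    algebraMap (Polynomial ℚ) (RatFunc ℚ) (hpol' G) =
      RatFunc.X ^ (2 * K + 3) * Polynomial.aeval ((RatFunc.X : RatFunc ℚ)⁻¹) (hpol G) := by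
  rw [hpol, hpol', map_sum, map_sum, Finset.mul_sum]
  refine Finset.sum_congr rfl fun S _ => ?_
  rw [map_sum, map_sum, Finset.mul_sum]
  refine Finset.sum_congr rfl fun σ _ => ?_
  have hx : (RatFunc.X : RatFunc ℚ) ≠ 0 := RatFunc.X_ne_zero
  rw [← Eexp_add S σ]
  simp only [map_pow, RatFunc.algebraMap_X, Polynomial.aeval_X, pow_add, inv_pow]
  field_simp

lemma dpol_inv (K : ℕ) :
    RatFunc.X ^ (2 * K + 3) * Polynomial.aeval ((RatFunc.X : RatFunc ℚ)⁻¹) (dpol K) =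
      (-1) ^ (K + 2) * algebraMap (Polynomial ℚ) (RatFunc ℚ) (dpol K) := by
  have hx : (RatFunc.X : RatFunc ℚ) ≠ 0 := RatFunc.X_ne_zero
  simp only [dpol, map_mul, map_sub, map_one, map_pow, RatFunc.algebraMap_X, Polynomial.aeval_X]
  have e : (RatFunc.X : RatFunc ℚ) ^ (2 * K + 3) = RatFunc.X * (RatFunc.X ^ 2) ^ (K+1) := by ring
  rw [e]
  calc _ = (RatFunc.X * (1 - (RatFunc.X : RatFunc ℚ)⁻¹)) *
        (RatFunc.X ^ 2 * (1 - (RatFunc.X : RatFunc ℚ)⁻¹ ^ 2)) ^ (K+1) := by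
        rw [mul_pow]; ring
    _ = (-1 * (1 - RatFunc.X)) * (-1 * (1 - (RatFunc.X : RatFunc ℚ) ^ 2)) ^ (K+1) := by
        have e1 : RatFunc.X * (1 - (RatFunc.X : RatFunc ℚ)⁻¹) = -1 * (1 - RatFunc.X) := by
          field_simp; ring
        have e2 : RatFunc.X ^ 2 * (1 - (RatFunc.X : RatFunc ℚ)⁻¹ ^ 2) =
            -1 * (1 - RatFunc.X ^ 2) := by
          field_simp; ring
        rw [e1, e2]
    _ = _ := by rw [mul_pow]; ring

lemma dpol_ne (K : ℕ) : dpol K ≠ 0 := by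
  intro h
  have := congrArg (fun p => Polynomial.eval 2 p) h
  simp [dpol] at this
  norm_num at this

lemma ehr_eq {m : ℕ} (G : SimpleGraph (Fin m)) (n : ℕ) :
    ehr (graphPolytope G) n = (Cset G n).card := by
  have hmem : ∀ p : Fin m → ℤ, (fun i => (p i : ℝ)) ∈ (n : ℝ) • graphPolytope G ↔
      (∀ i, 0 ≤ p i ∧ p i ≤ n) ∧ ∀ i j, G.Adj i j → p i + p j ≤ n := by
    intro p
    rcases Nat.eq_zero_or_pos n with rfl | hn
    · have hne : (graphPolytope G).Nonempty := ⟨0, by simp [graphPolytope]⟩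
      rw [Nat.cast_zero, Set.zero_smul_set hne, Set.mem_zero]
      constructor
      · intro h
        have h' : ∀ i, p i = 0 := fun i => by
          have := congrFun h i
          simpa using this
        simp [h']
      · rintro ⟨h, _⟩
        funext i
        have := h i
        have : p i = 0 := by push_cast at this; omega
        simp [this]
    · have hn' : (0 : ℝ) < n := by exact_mod_cast hn
      rw [Set.mem_smul_set_iff_inv_smul_mem₀ hn'.ne']
      simp only [graphPolytope, Set.mem_ofPred_eq, Pi.smul_apply, smul_eq_mul]
      refine and_congr (forall_congr' fun i => and_congr ?_ ?_)
        (forall_congr' fun i => forall_congr' fun j => imp_congr_right fun _ => ?_)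
      · rw [mul_nonneg_iff_of_pos_left (inv_pos.2 hn')]; exact_mod_cast Iff.rfl
      · rw [inv_mul_le_iff₀ hn', mul_one]; exact_mod_cast Iff.rfl
      · rw [← mul_add, inv_mul_le_iff₀ hn', mul_one]; exact_mod_cast Iff.rfl
  unfold ehr
  have hset : {p : Fin m → ℤ | (fun i => (p i : ℝ)) ∈ (n : ℝ) • graphPolytope G} =
      (fun (x : Fin m → ℕ) i => (x i : ℤ)) '' (Cset G n : Set (Fin m → ℕ)) := by
    ext p
    rw [Set.mem_ofPred_eq, hmem, Set.mem_image]
    constructor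
    · rintro ⟨h1, h2⟩
      refine ⟨fun i => (p i).toNat, ?_, ?_⟩
      · rw [Finset.mem_coe, mem_Cset]
        refine ⟨fun i => ?_, fun i j hij => ?_⟩
        · have := h1 i; omega
        · have := h1 i; have := h1 j; have := h2 i j hij; omega
      · funext i
        have := h1 i
        dsimp only; omega
    · rintro ⟨x, hx, rfl⟩
      rw [Finset.mem_coe, mem_Cset] at hx
      refine ⟨fun i => ?_, fun i j hij => ?_⟩
      · have := hx.1 i; dsimp only; omega
      · have := hx.2 i j hij; dsimp only; omega
  rw [hset, Set.ncard_image_of_injective, Set.ncard_coe_finset]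
  intro x y h
  funext i
  have := congrFun h i
  simpa using this

theorem stmt3 {k : ℕ} (hk : 2 ≤ k) (G : SimpleGraph (Fin k)) (hconn : G.Connected)
    (A B : Polynomial ℚ) (hB0 : B.coeff 0 ≠ 0)
    (hf : (A : PowerSeries ℚ) = (B : PowerSeries ℚ) * ehrSeries (graphPolytope G)) :
    (RatFunc.X : RatFunc ℚ) ^ 3 * algebraMap (Polynomial ℚ) (RatFunc ℚ) A *
        Polynomial.aeval ((RatFunc.X : RatFunc ℚ)⁻¹) B =
      (-1) ^ (k + 1) * Polynomial.aeval ((RatFunc.X : RatFunc ℚ)⁻¹) A *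
        algebraMap (Polynomial ℚ) (RatFunc ℚ) B := by
  obtain ⟨K, rfl⟩ : ∃ K, k = K + 1 := ⟨k - 1, by omega⟩
  have hG : ∀ i, ∃ j, G.Adj i j := by
    intro i
    haveI : Nontrivial (Fin (K+1)) := Fin.nontrivial_iff_two_le.2 hk
    obtain ⟨j, hj⟩ := exists_ne i
    obtain ⟨w⟩ := hconn.preconnected i j
    cases w with
    | nil => exact absurd rfl hj
    | cons h _ => exact ⟨_, h⟩
  have hE : ehrSeries (graphPolytope G) = PowerSeries.mk fun n => ((Cset G n).card : ℚ) := by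
    unfold ehrSeries
    simp only [ehr_eq]
  have hpoly : A * dpol K = B * hpol G := by
    apply Polynomial.coe_injective
    rw [Polynomial.coe_mul, Polynomial.coe_mul, hf, hE, mul_assoc, C_gf]
  have h1 := congrArg (algebraMap (Polynomial ℚ) (RatFunc ℚ)) hpoly
  have h2 := congrArg (Polynomial.aeval ((RatFunc.X : RatFunc ℚ)⁻¹)) hpoly
  have h3 := congrArg (algebraMap (Polynomial ℚ) (RatFunc ℚ)) (hpol_rel G hG)
  rw [hpol_inv] at h3
  have h4 := dpol_inv K
  have hd : algebraMap (Polynomial ℚ) (RatFunc ℚ) (dpol K) ≠ 0 :=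
    RatFunc.algebraMap_ne_zero (dpol_ne K)
  simp only [map_mul, map_pow, RatFunc.algebraMap_X] at h1 h2 h3
  apply mul_right_cancel₀ hd
  generalize algebraMap (Polynomial ℚ) (RatFunc ℚ) (dpol K) = dD at *
  generalize algebraMap (Polynomial ℚ) (RatFunc ℚ) A = a at *
  generalize algebraMap (Polynomial ℚ) (RatFunc ℚ) B = b at *
  generalize algebraMap (Polynomial ℚ) (RatFunc ℚ) (hpol G) = c at *
  generalize Polynomial.aeval ((RatFunc.X : RatFunc ℚ)⁻¹) (dpol K) = dD' at *
  generalize Polynomial.aeval ((RatFunc.X : RatFunc ℚ)⁻¹) A = a' at *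
  generalize Polynomial.aeval ((RatFunc.X : RatFunc ℚ)⁻¹) B = b' at *
  generalize Polynomial.aeval ((RatFunc.X : RatFunc ℚ)⁻¹) (hpol G) = c' at *
  have e : (-1 : RatFunc ℚ) ^ (K + 1 + 1) = (-1) ^ (K + 2) := rfl
  rw [e]
  linear_combination (RatFunc.X ^ 3 * b') * h1 - (b * b') * h3 -
    (RatFunc.X ^ (2 * K + 3) * b) * h2 + (a' * b) * h4
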